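/- arXiv:2507.00489 — 7 statements merged into one kernel-verified Lean document; each statement's English description precedes it below -/
import Mathlib

section
/- For every 1 ≤ i ≤ R, the expected value of N_i over a uniformly random permutation σ equals i(N−R)/(R+1); equivalently, (R+1) · Σ_σ N_i(σ) = i · (N−R) · N!, where the sum ranges over all N! permutations σ of Fin N. -/
/-- `numUnmarkedBefore M σ i` is the number of unmarked items (items not in `M`) that appear
strictly before the `i`-th marked item in the listing `σ 0, σ 1, …, σ (N-1)`.
(An unmarked item at position `j` lies strictly before the `i`-th marked item iff fewer than
`i` marked items occupy positions before `j`.)  In particular `numUnmarkedBefore M σ 0 = 0`. -/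
def numUnmarkedBefore {N : ℕ} (M : Finset (Fin N)) (σ : Equiv.Perm (Fin N)) (i : ℕ) : ℕ :=
  (Finset.univ.filter fun j : Fin N =>
    σ j ∉ M ∧ (Finset.univ.filter fun k : Fin N => σ k ∈ M ∧ k < j).card < i).card

open Finset in
/-- An injective function into a linear order lists any finset `S` in increasing order; exactly
`i` elements of `S` have fewer than `i` predecessors in this list. -/
theorem card_filter_rank_lt {α β : Type*} [LinearOrder β] {f : α → β}
    (hf : Function.Injective f) (S : Finset α) {i : ℕ} (hi : i ≤ #S) :
    #{v ∈ S | #{m ∈ S | f m < f v} < i} = i := by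
  set rank : α → ℕ := fun v => #{m ∈ S | f m < f v}
  have rank_lt : ∀ v ∈ S, ∀ w, f v < f w → rank v < rank w := by
    intro v hv w hvw
    refine card_lt_card ((ssubset_iff_of_subset fun m hm => ?_).2 ⟨v, ?_, ?_⟩)
    · rw [mem_filter] at hm ⊢
      exact ⟨hm.1, hm.2.trans hvw⟩
    · simp [hv, hvw]
    · simp
  have inj : Set.InjOn rank S := by
    intro v hv w hw h
    by_contra hne
    rcases lt_or_gt_of_ne (hf.ne hne) with hlt | hlt
    · exact (rank_lt v hv w hlt).ne h
    · exact (rank_lt w hw v hlt).ne h.symm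
  have image_rank : S.image rank = range #S := by
    refine eq_of_subset_of_card_le (fun k hk => ?_) ?_
    · obtain ⟨v, hv, rfl⟩ := mem_image.1 hk
      refine mem_range.2 (card_lt_card ((ssubset_iff_of_subset (filter_subset _ _)).2 ⟨v, hv, ?_⟩))
      simp
    · rw [card_image_of_injOn inj, card_range]
  have image_filter : (S.filter fun v => rank v < i).image rank = range i := by
    have h := filter_image (s := S) (f := rank) (p := fun k => k < i)
    rw [← h, image_rank]
    ext k
    simp only [mem_filter, mem_range]
    omega
  rw [← card_image_of_injOn (inj.mono (filter_subset _ _)), image_filter, card_range]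

open Finset in
/-- The rank of an element `u` of `S` in a uniformly random ordering is uniform on
`{0, …, #S - 1}`. -/
theorem card_mul_card_perm_rank_lt {α : Type*} [Fintype α] [LinearOrder α] (S : Finset α)
    {u : α} (hu : u ∈ S) {i : ℕ} (hi : i ≤ #S) :
    #S * #{τ : Equiv.Perm α | #{m ∈ S | τ m < τ u} < i} = i * (Fintype.card α).factorial := by
  have card_eq : ∀ v ∈ S, #{τ : Equiv.Perm α | #{m ∈ S | τ m < τ v} < i}
      = #{τ : Equiv.Perm α | #{m ∈ S | τ m < τ u} < i} := by
    intro v hv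
    have mem_swap : ∀ m, Equiv.swap u v m ∈ S ↔ m ∈ S := by
      intro m
      rw [Equiv.swap_apply_def]
      split_ifs <;> simp_all
    refine card_equiv (Equiv.mulRight (Equiv.swap u v)) fun τ => ?_
    have h : #{m ∈ S | τ m < τ v} = #{m ∈ S | τ (Equiv.swap u v m) < τ v} :=
      card_equiv (Equiv.swap u v) fun m => by simp [mem_swap]
    simp [h]
  calc #S * #{τ : Equiv.Perm α | #{m ∈ S | τ m < τ u} < i}
      = ∑ v ∈ S, #{τ : Equiv.Perm α | #{m ∈ S | τ m < τ v} < i} := by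
        rw [sum_congr rfl card_eq, sum_const, smul_eq_mul]
    _ = ∑ τ : Equiv.Perm α, #{v ∈ S | #{m ∈ S | τ m < τ v} < i} := by
        simp only [card_filter _ S, card_filter _ univ]
        exact sum_comm
    _ = i * (Fintype.card α).factorial := by
        simp [card_filter_rank_lt (Equiv.injective _) S hi, Fintype.card_perm, mul_comm]

open Finset in
theorem numUnmarkedBefore_eq_card_symm {N : ℕ} (M : Finset (Fin N)) (σ : Equiv.Perm (Fin N))
    (i : ℕ) :
    numUnmarkedBefore M σ i
      = #{u ∈ Mᶜ | #{m ∈ insert u M | σ.symm m < σ.symm u} < i} := by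
  refine card_equiv σ fun j => ?_
  have h : #{k | σ k ∈ M ∧ k < j} = #{m ∈ insert (σ j) M | σ.symm m < j} := by
    refine card_equiv σ fun k => ?_
    simp only [mem_filter, mem_univ, true_and, mem_insert, Equiv.symm_apply_apply,
      EmbeddingLike.apply_eq_iff_eq]
    constructor
    · exact fun h => ⟨Or.inr h.1, h.2⟩
    · rintro ⟨rfl | h, hk⟩
      · exact absurd hk (lt_irrefl _)
      · exact ⟨h, hk⟩
  simp [h]

/-- For every `1 ≤ i ≤ R`, the expected value of `N_i` over a uniformly random permutation
equals `i (N − R) / (R + 1)`, i.e. `(R+1) · Σ_σ N_i(σ) = i · (N − R) · N!`. -/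
theorem stmt_2 (N R : ℕ) (hN : 1 ≤ N) (M : Finset (Fin N)) (hM : M.card = R)
    (hR : 1 ≤ R) (hRN : R ≤ N) (i : ℕ) (hi1 : 1 ≤ i) (hiR : i ≤ R) :
    (R + 1) * ∑ σ : Equiv.Perm (Fin N), numUnmarkedBefore M σ i
      = i * (N - R) * N.factorial := by
  have sum_eq : ∑ σ : Equiv.Perm (Fin N), numUnmarkedBefore M σ i
      = ∑ u ∈ Mᶜ, (Finset.univ.filter fun τ : Equiv.Perm (Fin N) =>
          ((insert u M).filter fun m => τ m < τ u).card < i).card := by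
    simp only [numUnmarkedBefore_eq_card_symm]
    rw [← Equiv.sum_comp (Equiv.inv (Equiv.Perm (Fin N)))]
    simp only [Finset.card_filter _ Mᶜ, Finset.card_filter _ Finset.univ]
    exact Finset.sum_comm
  have term_eq : ∀ u ∈ Mᶜ, (R + 1) * (Finset.univ.filter fun τ : Equiv.Perm (Fin N) =>
      ((insert u M).filter fun m => τ m < τ u).card < i).card = i * N.factorial := by
    intro u hu
    have card_insert : (insert u M).card = R + 1 := by
      rw [Finset.card_insert_of_notMem (Finset.mem_compl.1 hu), hM]
    have h := card_mul_card_perm_rank_lt (insert u M) (Finset.mem_insert_self u M) (i := i)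
      (by omega)
    rwa [card_insert, Fintype.card_fin] at h
  rw [sum_eq, Finset.mul_sum, Finset.sum_congr rfl term_eq, Finset.sum_const,
    Finset.card_compl, Fintype.card_fin, hM, smul_eq_mul]
  ring
end

section
/- For every 1 ≤ i ≤ R, the expected value of N_i − N_{i−1} + 1 over a uniformly random permutation σ equals (N+1)/(R+1); equivalently, (R+1) · Σ_σ (N_i(σ) − N_{i−1}(σ) + 1) = (N+1) · N!, where the sum ranges over all N! permutations σ of Fin N. -/
/-- The number of elements of `S` that `τ` places strictly before `w`. -/
def placeRank {N : ℕ} (S : Finset (Fin N)) (τ : Equiv.Perm (Fin N)) (w : Fin N) : ℕ :=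
  (S.filter fun v => τ v < τ w).card

lemma placeRank_lt_placeRank {N : ℕ} {S : Finset (Fin N)} {τ : Equiv.Perm (Fin N)} {v w : Fin N}
    (hv : v ∈ S) (h : τ v < τ w) : placeRank S τ v < placeRank S τ w := by
  refine Finset.card_lt_card (Finset.ssubset_iff_of_subset ?_ |>.2 ⟨v, ?_, ?_⟩)
  · intro x hx
    simp only [Finset.mem_filter] at hx ⊢
    exact ⟨hx.1, hx.2.trans h⟩
  · simp [hv, h]
  · simp

lemma injOn_placeRank {N : ℕ} (S : Finset (Fin N)) (τ : Equiv.Perm (Fin N)) :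
    Set.InjOn (placeRank S τ) S := by
  intro v hv w hw h
  rcases lt_trichotomy (τ v) (τ w) with h1 | h1 | h1
  · exact absurd h (placeRank_lt_placeRank hv h1).ne
  · exact τ.injective h1
  · exact absurd h (placeRank_lt_placeRank hw h1).ne'

lemma image_placeRank {N : ℕ} (S : Finset (Fin N)) (τ : Equiv.Perm (Fin N)) :
    S.image (placeRank S τ) = Finset.range S.card := by
  refine Finset.eq_of_subset_of_card_le ?_ ?_
  · intro m hm
    obtain ⟨w, hw, rfl⟩ := Finset.mem_image.1 hm
    refine Finset.mem_range.2 (Finset.card_lt_card ?_)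
    exact Finset.filter_ssubset.2 ⟨w, hw, lt_irrefl _⟩
  · rw [Finset.card_image_of_injOn (injOn_placeRank S τ), Finset.card_range]

lemma card_filter_placeRank_eq {N : ℕ} (S : Finset (Fin N)) (τ : Equiv.Perm (Fin N)) {m : ℕ}
    (hm : m < S.card) : (S.filter fun w => placeRank S τ w = m).card = 1 := by
  have h : m ∈ S.image (placeRank S τ) := by
    rw [image_placeRank]
    exact Finset.mem_range.2 hm
  obtain ⟨w, hw, rfl⟩ := Finset.mem_image.1 h
  refine Finset.card_eq_one.2 ⟨w, ?_⟩
  ext x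
  simp only [Finset.mem_filter, Finset.mem_singleton]
  exact ⟨fun hx => injOn_placeRank S τ hx.1 hw hx.2, by rintro rfl; exact ⟨hw, rfl⟩⟩

lemma placeRank_mul_swap {N : ℕ} {S : Finset (Fin N)} (τ : Equiv.Perm (Fin N)) {u w : Fin N}
    (hu : u ∈ S) (hw : w ∈ S) : placeRank S (τ * Equiv.swap u w) w = placeRank S τ u := by
  refine Finset.card_equiv (Equiv.swap u w) fun v => ?_
  have h : Equiv.swap u w v ∈ S ↔ v ∈ S := by
    rw [Equiv.swap_apply_def]
    split_ifs <;> simp_all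
  simp [h]

/-- The rank of a fixed element of `S` in a uniformly random order is uniform. -/
lemma card_mul_card_placeRank_eq {N : ℕ} {S : Finset (Fin N)} {u : Fin N} (hu : u ∈ S) {m : ℕ}
    (hm : m < S.card) :
    S.card * (Finset.univ.filter fun τ : Equiv.Perm (Fin N) => placeRank S τ u = m).card
      = N.factorial := by
  have hsym : ∀ w ∈ S,
      (Finset.univ.filter fun τ : Equiv.Perm (Fin N) => placeRank S τ w = m).card
        = (Finset.univ.filter fun τ : Equiv.Perm (Fin N) => placeRank S τ u = m).card := by
    intro w hw
    symm
    refine Finset.card_equiv (Equiv.mulRight (Equiv.swap u w)) fun τ => ?_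
    simp [placeRank_mul_swap τ hu hw]
  rw [← smul_eq_mul, ← Finset.sum_const, ← Finset.sum_congr rfl hsym]
  have h := Finset.sum_card_bipartiteAbove_eq_sum_card_bipartiteBelow (s := S)
    (t := (Finset.univ : Finset (Equiv.Perm (Fin N)))) (fun w τ => placeRank S τ w = m)
  simp only [Finset.bipartiteAbove, Finset.bipartiteBelow] at h
  rw [h, Finset.sum_congr rfl fun τ _ => card_filter_placeRank_eq S τ hm]
  simp [Fintype.card_perm]

lemma placeRank_insert_self {N : ℕ} (M : Finset (Fin N)) (τ : Equiv.Perm (Fin N)) (u : Fin N) :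
    placeRank (insert u M) τ u = placeRank M τ u := by
  simp [placeRank, Finset.filter_insert]

lemma numUnmarkedBefore_eq_card_placeRank_lt {N : ℕ} (M : Finset (Fin N))
    (σ : Equiv.Perm (Fin N)) (i : ℕ) :
    numUnmarkedBefore M σ i = (Mᶜ.filter fun u => placeRank M σ⁻¹ u < i).card := by
  refine Finset.card_equiv σ fun j => ?_
  have h : (Finset.univ.filter fun k : Fin N => σ k ∈ M ∧ k < j).card
      = placeRank M σ⁻¹ (σ j) :=
    Finset.card_equiv σ fun k => by simp
  simp [h]

lemma numUnmarkedBefore_succ {N : ℕ} (M : Finset (Fin N)) (σ : Equiv.Perm (Fin N)) (m : ℕ) :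
    numUnmarkedBefore M σ (m + 1)
      = numUnmarkedBefore M σ m + (Mᶜ.filter fun u => placeRank M σ⁻¹ u = m).card := by
  rw [numUnmarkedBefore_eq_card_placeRank_lt, numUnmarkedBefore_eq_card_placeRank_lt,
    ← Finset.card_union_of_disjoint, ← Finset.filter_or]
  · simp only [Nat.lt_succ_iff_lt_or_eq]
  · exact Finset.disjoint_filter.2 fun u _ h => h.ne

lemma card_succ_mul_sum_card_placeRank_eq {N : ℕ} (M : Finset (Fin N)) {m : ℕ}
    (hm : m ≤ M.card) :
    (M.card + 1) * ∑ σ : Equiv.Perm (Fin N), (Mᶜ.filter fun u => placeRank M σ⁻¹ u = m).card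
      = (N - M.card) * N.factorial := by
  have h := Finset.sum_card_bipartiteAbove_eq_sum_card_bipartiteBelow (s := Mᶜ)
    (t := (Finset.univ : Finset (Equiv.Perm (Fin N)))) (fun w τ => placeRank M τ w = m)
  simp only [Finset.bipartiteAbove, Finset.bipartiteBelow] at h
  have hinv := Equiv.sum_comp (Equiv.inv (Equiv.Perm (Fin N))) fun τ =>
    (Mᶜ.filter fun u => placeRank M τ u = m).card
  simp only [Equiv.inv_apply] at hinv
  rw [hinv, ← h, Finset.mul_sum, Finset.sum_congr rfl (g := fun _ => N.factorial)]
  · simp [Finset.card_compl]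
  · intro u hu
    have hc := Finset.card_insert_of_notMem (Finset.mem_compl.1 hu)
    have := card_mul_card_placeRank_eq (Finset.mem_insert_self u M) (m := m) (by omega)
    simpa only [hc, placeRank_insert_self] using this

/-- For every `1 ≤ i ≤ R`, the expected value of `N_i − N_{i−1} + 1` over a uniformly random
permutation equals `(N+1)/(R+1)`, i.e. `(R+1) · Σ_σ (N_i(σ) − N_{i−1}(σ) + 1) = (N+1) · N!`. -/
theorem stmt_3 (N R : ℕ) (hN : 1 ≤ N) (M : Finset (Fin N)) (hM : M.card = R)
    (hR : 1 ≤ R) (hRN : R ≤ N) (i : ℕ) (hi1 : 1 ≤ i) (hiR : i ≤ R) :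
    ((R : ℤ) + 1) * ∑ σ : Equiv.Perm (Fin N),
        ((numUnmarkedBefore M σ i : ℤ) - (numUnmarkedBefore M σ (i - 1) : ℤ) + 1)
      = ((N : ℤ) + 1) * N.factorial := by
  subst hM
  obtain ⟨m, rfl⟩ : ∃ m, i = m + 1 := ⟨i - 1, by omega⟩
  have h := card_succ_mul_sum_card_placeRank_eq M (m := m) (by omega)
  have h' := congrArg (Nat.cast : ℕ → ℤ) h
  push_cast [Nat.cast_sub hRN] at h'
  simp only [Nat.add_sub_cancel, numUnmarkedBefore_succ, Nat.cast_add, add_sub_cancel_left,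
    Finset.sum_add_distrib, Finset.sum_const, Finset.card_univ, Fintype.card_perm,
    Fintype.card_fin, nsmul_eq_mul, mul_one]
  linear_combination h'
end

section
/- Let r : Fin d → Fin n be strictly monotone and let t : Fin d → ℕ satisfy mn(r(j)) ≤ t(j) ≤ mx(r(j)) for all j. If (l,h) is a range filter with split position s, then t satisfies the filter restricted to the coordinates r, i.e. l(r(j)) ≤ t(j) ≤ h(r(j)) for all j ∈ Fin d, if and only if the tuple t lies lexicographically between l∘r and h∘r, i.e. toLex (l∘r) ≤ toLex t and toLex t ≤ toLex (h∘r) in the lexicographic order on Fin d → ℕ. -/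
/-- `s` is a split position of the range filter `(l, h)` (relative to the active-domain
bounds `mn`, `mx`): `l i = h i` for all `i < s`, `l s ≤ h s`, and `l i = mn i`, `h i = mx i`
for all `i > s`. -/
def IsSplitPos {n : ℕ} (mn mx l h : Fin n → ℕ) (s : Fin n) : Prop :=
  (∀ i, i < s → l i = h i) ∧ l s ≤ h s ∧ ∀ i, s < i → l i = mn i ∧ h i = mx i

/-- For a prefix range filter `(l,h)` with split position `s`, a tuple `t` on the strictly
monotone coordinate list `r` whose entries lie within the active domains satisfies the
filter componentwise iff it lies lexicographically between `l ∘ r` and `h ∘ r`. -/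
theorem stmt_7 (n d : ℕ) (hn : 1 ≤ n) (mn mx : Fin n → ℕ) (hdom : ∀ i, mn i ≤ mx i)
    (l h : Fin n → ℕ) (s : Fin n) (hs : IsSplitPos mn mx l h s)
    (r : Fin d → Fin n) (hr : StrictMono r)
    (t : Fin d → ℕ) (ht : ∀ j, mn (r j) ≤ t j ∧ t j ≤ mx (r j)) :
    (∀ j, l (r j) ≤ t j ∧ t j ≤ h (r j)) ↔
      toLex (l ∘ r) ≤ toLex t ∧ toLex t ≤ toLex (h ∘ r) := by
  obtain ⟨hlt, -, hgt⟩ := hs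
  refine ⟨fun H => ⟨Pi.toLex_monotone fun j => (H j).1, Pi.toLex_monotone fun j => (H j).2⟩, ?_⟩
  rintro ⟨hl, hh⟩
  have bounds : ∀ j, (∀ k < j, l (r k) = t k ∧ t k = h (r k)) →
      l (r j) ≤ t j ∧ t j ≤ h (r j) := fun j hj =>
    ⟨Pi.apply_le_of_toLex hl fun k hk => (hj k hk).1,
      Pi.apply_le_of_toLex hh fun k hk => (hj k hk).2⟩
  have below : ∀ j, r j < s → l (r j) = t j ∧ t j = h (r j) := by
    intro j
    induction j using WellFoundedLT.induction with
    | ind j ih =>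
      intro hj
      have hb := bounds j fun k hk => ih k hk ((hr hk).trans hj)
      have he := hlt (r j) hj
      omega
  intro j
  rcases le_or_gt (r j) s with hj | hj
  · exact bounds j fun k hk => below k ((hr hk).trans_le hj)
  · rw [(hgt _ hj).1, (hgt _ hj).2]
    exact ht j
end

section
/- Let (l,h) be a prefix range filter whose minimal differing coordinate s = min{ i : l(i) ≠ h(i) } exists (so s is a split position), and let p be an integer with l(s) ≤ p ≤ h(s). Define ψ_left, ψ_mid, ψ_right to be the range filters obtained from (l,h) by replacing the interval [l(s),h(s)] at coordinate s with [l(s),p−1], [p,p], and [p+1,h(s)] respectively. Then ψ_mid is a prefix range filter; if l(s) ≤ p−1 then ψ_left is a prefix range filter; and if p+1 ≤ h(s) then ψ_right is a prefix range filter. -/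
/-- Dividing a prefix range filter `(l,h)` at its minimal differing coordinate `s` with a
division point `l s ≤ p ≤ h s`: the middle part `ψ_mid` (coordinate `s` replaced by `[p,p]`)
is a prefix range filter; if `l s ≤ p − 1` then the left part `ψ_left` (coordinate `s`
replaced by `[l s, p−1]`) is a prefix range filter; and if `p + 1 ≤ h s` then the right part
`ψ_right` (coordinate `s` replaced by `[p+1, h s]`) is a prefix range filter. -/
theorem stmt_9 (n : ℕ) (hn : 1 ≤ n) (mn mx : Fin n → ℕ) (hdom : ∀ i, mn i ≤ mx i)
    (l h : Fin n → ℕ)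
    (hpre : ∃ s', IsSplitPos mn mx l h s')
    (hne : (Finset.univ.filter fun i => l i ≠ h i).Nonempty)
    (s : Fin n) (hs : s = (Finset.univ.filter fun i => l i ≠ h i).min' hne)
    (p : ℕ) (hlp : l s ≤ p) (hph : p ≤ h s) :
    (∃ s', IsSplitPos mn mx (Function.update l s p) (Function.update h s p) s') ∧
    (l s + 1 ≤ p →
      ∃ s', IsSplitPos mn mx l (Function.update h s (p - 1)) s') ∧
    (p + 1 ≤ h s →
      ∃ s', IsSplitPos mn mx (Function.update l s (p + 1)) h s') := by
  obtain ⟨s', hlt', -, hgt'⟩ := hpre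
  have hs_ne : l s ≠ h s := by
    simpa [← hs] using Finset.min'_mem _ hne
  have hlt : ∀ i, i < s → l i = h i := fun i hi => by
    by_contra hi_ne
    exact absurd (Finset.min'_le _ i (by simpa using hi_ne)) (not_le.mpr (hs ▸ hi))
  have hs's : s' ≤ s := not_lt.mp fun hss' => hs_ne (hlt' s hss')
  have hgt : ∀ i, s < i → l i = mn i ∧ h i = mx i := fun i hi =>
    hgt' i (hs's.trans_lt hi)
  refine ⟨⟨s, ?_, ?_, ?_⟩, fun hp => ⟨s, ?_, ?_, ?_⟩, fun hp => ⟨s, ?_, ?_, ?_⟩⟩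
  all_goals first
    | intro i hi
      simpa [hi.ne, hi.ne'] using hlt i hi
    | intro i hi
      simpa [hi.ne, hi.ne'] using hgt i hi
    | simp only [Function.update_self]
      omega
end

section
/- Let m_i ∈ Fin n_i be an index for each 1 ≤ i ≤ k, and let p = min_{1 ≤ i ≤ k} A_i(m_i). If F(m_1,…,m_k) ≤ T (where each index m_i is interpreted as the natural number of elements preceding position m_i), then F(N_1(p),…,N_k(p)) ≤ T. -/
/-- `cntBelow A i p` is `N_i(p)`: the number of indices `j` with `A i j < p`. -/
def cntBelow {k : ℕ} {n : Fin k → ℕ} (A : (i : Fin k) → Fin (n i) → ℕ)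
    (i : Fin k) (p : ℕ) : ℕ :=
  (Finset.univ.filter fun j : Fin (n i) => A i j < p).card

/-- If `p = min_i A_i(m_i)` and `F(m_1,…,m_k) ≤ T`, then `F(N_1(p),…,N_k(p)) ≤ T`. -/
theorem stmt_12 (k : ℕ) (hk : 0 < k) (n : Fin k → ℕ) (hn : ∀ i, 1 ≤ n i)
    (A : (i : Fin k) → Fin (n i) → ℕ) (hA : ∀ i, Monotone (A i))
    (F : (Fin k → ℕ) → ℕ) (hF : Monotone F) (T : ℕ)
    (m : (i : Fin k) → Fin (n i))
    (p : ℕ) (hp : (∃ i, p = A i (m i)) ∧ ∀ i, p ≤ A i (m i))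
    (hm : F (fun i => (m i : ℕ)) ≤ T) :
    F (fun i => cntBelow A i p) ≤ T := by
  refine (hF fun i => ?_).trans hm
  calc cntBelow A i p ≤ (Finset.Iio (m i)).card := Finset.card_le_card fun j hj =>
        Finset.mem_Iio.2 ((hA i).reflect_lt ((Finset.mem_filter.1 hj).2.trans_le (hp.2 i)))
    _ = m i := Fin.card_Iio _
end

section
/- Let m_i ∈ Fin n_i be an index for each 1 ≤ i ≤ k, and let p = max_{1 ≤ i ≤ k} A_i(m_i). If F(m_1,…,m_k) > T (where each index m_i is interpreted as the natural number of elements preceding position m_i), then F(N_1(p+1),…,N_k(p+1)) > T. -/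
/-- In a monotone array, every index whose entry is below `p` is less than the count of such
indices. -/
theorem lt_cntBelow {k : ℕ} {n : Fin k → ℕ} {A : (i : Fin k) → Fin (n i) → ℕ} {i : Fin k}
    (hA : Monotone (A i)) {j : Fin (n i)} {p : ℕ} (hj : A i j < p) :
    (j : ℕ) < cntBelow A i p := by
  have hsub : Finset.Iic j ⊆ Finset.univ.filter fun l : Fin (n i) => A i l < p := fun l hl =>
    Finset.mem_filter.2 ⟨Finset.mem_univ l, (hA (Finset.mem_Iic.1 hl)).trans_lt hj⟩
  have hcard := Finset.card_le_card hsub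
  rw [Fin.card_Iic] at hcard
  exact hcard

/-- If `p = max_i A_i(m_i)` and `F(m_1,…,m_k) > T`, then `F(N_1(p+1),…,N_k(p+1)) > T`. -/
theorem stmt_13 (k : ℕ) (hk : 0 < k) (n : Fin k → ℕ) (hn : ∀ i, 1 ≤ n i)
    (A : (i : Fin k) → Fin (n i) → ℕ) (hA : ∀ i, Monotone (A i))
    (F : (Fin k → ℕ) → ℕ) (hF : Monotone F) (T : ℕ)
    (m : (i : Fin k) → Fin (n i))
    (p : ℕ) (hp : (∃ i, p = A i (m i)) ∧ ∀ i, A i (m i) ≤ p)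
    (hm : T < F (fun i => (m i : ℕ))) :
    T < F (fun i => cntBelow A i (p + 1)) := by
  exact hm.trans_le (hF fun i => (lt_cntBelow (hA i) (Nat.lt_succ_of_le (hp.2 i))).le)
end

section
/- Suppose that for each 1 ≤ i ≤ k we are given indices l_i, r_i ∈ Fin n_i with l_i ≤ r_i ≤ l_i + 1, and suppose that for every 1 ≤ i ≤ k, F(N_1(A_i(l_i)+1), …, N_k(A_i(l_i)+1)) ≤ T. Then, with p = min_{1 ≤ i ≤ k} A_i(r_i), we have F(N_1(p), …, N_k(p)) ≤ T. -/
/-- If the entries of `A i` below `p` are all at most `a`, then `N_i(p) ≤ N_i(a + 1)`. -/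
theorem cntBelow_le_cntBelow_succ {k : ℕ} {n : Fin k → ℕ} (A : (i : Fin k) → Fin (n i) → ℕ)
    (i : Fin k) {p a : ℕ} (h : ∀ j, A i j < p → A i j ≤ a) :
    cntBelow A i p ≤ cntBelow A i (a + 1) :=
  Finset.card_le_card <| Finset.monotone_filter_right _ fun j _ hj => Nat.lt_succ_of_le (h j hj)

/-- Termination step of Multi-Head Binary Search: given indices `l_i ≤ r_i ≤ l_i + 1` with
`F(N_1(A_i(l_i)+1),…,N_k(A_i(l_i)+1)) ≤ T` for every `i`, setting `p = min_i A_i(r_i)` we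
have `F(N_1(p),…,N_k(p)) ≤ T`. -/
theorem stmt_14 (k : ℕ) (hk : 0 < k) (n : Fin k → ℕ) (hn : ∀ i, 1 ≤ n i)
    (A : (i : Fin k) → Fin (n i) → ℕ) (hA : ∀ i, Monotone (A i))
    (F : (Fin k → ℕ) → ℕ) (hF : Monotone F) (T : ℕ)
    (l r : (i : Fin k) → Fin (n i))
    (hlr : ∀ i, (l i : ℕ) ≤ (r i : ℕ) ∧ (r i : ℕ) ≤ (l i : ℕ) + 1)
    (hT : ∀ i, F (fun j => cntBelow A j (A i (l i) + 1)) ≤ T)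
    (p : ℕ) (hp : (∃ i, p = A i (r i)) ∧ ∀ i, p ≤ A i (r i)) :
    F (fun i => cntBelow A i p) ≤ T := by
  have : Nonempty (Fin k) := ⟨⟨0, hk⟩⟩
  obtain ⟨m, hm⟩ := Finite.exists_max fun i => A i (l i)
  refine (hF fun i => cntBelow_le_cntBelow_succ A i fun j hj => ?_).trans (hT m)
  have hjr : j < r i := (hA i).reflect_lt (hj.trans_le (hp.2 i))
  have hjl : j ≤ l i := Fin.le_def.2 (Nat.le_of_lt_succ ((Fin.lt_def.1 hjr).trans_le (hlr i).2))
  exact (hA i hjl).trans (hm i)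
end
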